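/- arXiv:2510.07136 — 4 statements merged into one kernel-verified Lean document; each statement's English description precedes it below -/
import Mathlib

section
/- Let A ∈ {0,1}^{n×n} be a symmetric adjacency matrix with zero diagonal, let Ã be its symmetric randomized-response perturbation with flip probability μ ∈ [0,1/2), and let Z := Ã − E[Ã | A] be the centered noise matrix, whose independent entries are mean zero, bounded by 1 in absolute value, and have variance at most v_max := μ(1−μ). Then for any η ∈ (0,1), with probability at least 1−η, the spectral norm satisfies ‖Z‖₂ ≤ √( 2(n−1)·v_max·log(2n/η) ) + (1/3)·log(2n/η). -/
open MeasureTheory ProbabilityTheory Matrix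
open scoped ENNReal NNReal

set_option autoImplicit false

noncomputable section

instance matrixMeasurableSpace {n m : ℕ} : MeasurableSpace (Matrix (Fin n) (Fin m) ℝ) :=
  (inferInstance : MeasurableSpace (Fin n → Fin m → ℝ))

instance permMeasurableSpace {n : ℕ} : MeasurableSpace (Equiv.Perm (Fin n)) := ⊤

/-- Spectral (operator) norm of a real matrix. -/
noncomputable def specNorm {n m : ℕ} (M : Matrix (Fin n) (Fin m) ℝ) : ℝ :=
  ‖LinearMap.toContinuousLinearMap (Matrix.toEuclideanLin M)‖

/-- Frobenius norm of a real matrix. -/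
noncomputable def frobNorm {n m : ℕ} (M : Matrix (Fin n) (Fin m) ℝ) : ℝ :=
  Real.sqrt (∑ i, ∑ j, (M i j) ^ 2)

/-- Projection distance between column spans. -/
noncomputable def projDist {n k : ℕ} (U U' : Matrix (Fin n) (Fin k) ℝ) : ℝ :=
  specNorm (U * Uᵀ - U' * U'ᵀ)

/-- A is a {0,1} symmetric adjacency matrix with zero diagonal. -/
def IsAdj {n : ℕ} (A : Matrix (Fin n) (Fin n) ℝ) : Prop :=
  (∀ i j, A i j = 0 ∨ A i j = 1) ∧ A.IsSymm ∧ ∀ i, A i i = 0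

/-- A and A' differ in exactly one edge. -/
def NeighborAdj {n : ℕ} (A A' : Matrix (Fin n) (Fin n) ℝ) : Prop :=
  ∃ i j : Fin n, i < j ∧ A i j ≠ A' i j ∧
    ∀ a b : Fin n, (a, b) ≠ (i, j) → (a, b) ≠ (j, i) → A a b = A' a b

/-- (ε,δ)-edge differential privacy for a mechanism on adjacency matrices. -/
def EdgeDP {n : ℕ} {Ω : Type} [MeasurableSpace Ω]
    (M : Matrix (Fin n) (Fin n) ℝ → Measure Ω) (ε δ : ℝ) : Prop :=
  ∀ A A' : Matrix (Fin n) (Fin n) ℝ, IsAdj A → IsAdj A' → NeighborAdj A A' →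
    ∀ S : Set Ω, MeasurableSet S →
      M A S ≤ ENNReal.ofReal (Real.exp ε) * M A' S + ENNReal.ofReal δ

/-- Bernoulli(p) measure on Bool. -/
noncomputable def bernBool (p : ℝ) : Measure Bool :=
  ENNReal.ofReal p • Measure.dirac true + ENNReal.ofReal (1 - p) • Measure.dirac false

/-- iid Bernoulli(p) random booleans indexed by pairs. -/
noncomputable def flipPi (n : ℕ) (p : ℝ) : Measure (Fin n → Fin n → Bool) :=
  Measure.pi fun _ => Measure.pi fun _ => bernBool p

/-- Uniform distribution on permutations of [n]. -/
noncomputable def unifPerm (n : ℕ) : Measure (Equiv.Perm (Fin n)) :=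
  (PMF.uniformOfFintype (Equiv.Perm (Fin n))).toMeasure

/-- Apply randomized-response flips `f` to the strictly upper-triangular part of `A`,
mirroring to the lower triangle and forcing a zero diagonal. -/
def applyRR {n : ℕ} (A : Matrix (Fin n) (Fin n) ℝ) (f : Fin n → Fin n → Bool) :
    Matrix (Fin n) (Fin n) ℝ :=
  Matrix.of fun i j =>
    if i = j then 0
    else if i < j then (if f i j then 1 - A i j else A i j)
    else (if f j i then 1 - A j i else A j i)

/-- The shuffled randomized-response mechanism `M(A) = P Ã Pᵀ`, with
flip probability `μ = 1/(e^{ε₀}+1)` and a uniformly random permutation. -/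
noncomputable def shuffleMech (n : ℕ) (ε₀ : ℝ) (A : Matrix (Fin n) (Fin n) ℝ) :
    Measure (Matrix (Fin n) (Fin n) ℝ) :=
  ((flipPi n (1 / (Real.exp ε₀ + 1))).prod (unifPerm n)).map
    (fun fp => (applyRR A fp.1).submatrix fp.2 fp.2)

/-- Hockey-stick divergence `H_α(P‖Q) = sup_S (P S - α Q S)`. -/
noncomputable def hsDiv {α : Type*} [MeasurableSpace α] (a : ℝ≥0∞) (P Q : Measure α) : ℝ≥0∞ :=
  ⨆ (S : Set α) (_ : MeasurableSet S), P S - a * Q S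

/-- err rate: normalized Hamming distance minimized over label permutations. -/
noncomputable def errRate {n k : ℕ} (σh σs : Fin n → Fin k) : ℝ :=
  ((Finset.univ.inf' ⟨1, Finset.mem_univ 1⟩ fun π : Equiv.Perm (Fin k) =>
    (Finset.univ.filter fun i => π (σh i) ≠ σs i).card : ℕ) : ℝ) / n

/-- i-th row of a matrix, as a point of Euclidean space. -/
def rowsOf {n k : ℕ} (U : Matrix (Fin n) (Fin k) ℝ) (i : Fin n) : EuclideanSpace ℝ (Fin k) :=
  (WithLp.equiv 2 (Fin k → ℝ)).symm fun j => U i j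

/-- Mean of the points of cluster r. -/
noncomputable def clusterMean {n k : ℕ} (X : Fin n → EuclideanSpace ℝ (Fin k))
    (σ : Fin n → Fin k) (r : Fin k) : EuclideanSpace ℝ (Fin k) :=
  (((Finset.univ.filter fun i => σ i = r).card : ℝ))⁻¹ •
    ∑ i ∈ Finset.univ.filter fun i => σ i = r, X i

/-- k-means objective: sum of squared distances to the mean of own cluster. -/
noncomputable def kmeansCost {n k : ℕ} (X : Fin n → EuclideanSpace ℝ (Fin k))
    (σ : Fin n → Fin k) : ℝ :=
  ∑ i, ‖X i - clusterMean X σ (σ i)‖ ^ 2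

/-- σ is a global optimum of the k-means objective on the points X. -/
def IsKMeansOpt {n k : ℕ} (X : Fin n → EuclideanSpace ℝ (Fin k)) (σ : Fin n → Fin k) : Prop :=
  ∀ σ' : Fin n → Fin k, kmeansCost X σ ≤ kmeansCost X σ'

/-- Center of the ground-truth cluster r in the embedding U. -/
noncomputable def center {n k : ℕ} (U : Matrix (Fin n) (Fin k) ℝ) (σs : Fin n → Fin k)
    (r : Fin k) : EuclideanSpace ℝ (Fin k) :=
  clusterMean (rowsOf U) σs r

/-- Within-cluster quadratic radius of cluster r. -/
noncomputable def cradius {n k : ℕ} (U : Matrix (Fin n) (Fin k) ℝ) (σs : Fin n → Fin k)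
    (r : Fin k) : ℝ :=
  Real.sqrt ((((Finset.univ.filter fun i => σs i = r).card : ℝ))⁻¹ *
    ∑ i ∈ Finset.univ.filter fun i => σs i = r, ‖rowsOf U i - center U σs r‖ ^ 2)

/-- `U` consists of orthonormal eigenvectors of `M` for its `k` largest eigenvalues:
there is an orthogonal `V` with decreasing eigenvalue sequence `e` diagonalizing `M`,
and `U` is the first `k` columns of `V`. -/
def IsTopEigenvectors {n k : ℕ} (hkn : k ≤ n) (M : Matrix (Fin n) (Fin n) ℝ)
    (U : Matrix (Fin n) (Fin k) ℝ) : Prop :=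
  ∃ (V : Matrix (Fin n) (Fin n) ℝ) (e : Fin n → ℝ),
    Vᵀ * V = 1 ∧ (∀ i j : Fin n, i ≤ j → e j ≤ e i) ∧
    M = V * Matrix.diagonal e * Vᵀ ∧ (U = Matrix.of fun i j => V i (Fin.castLE hkn j))

/-- `U` consists of top-k left singular vectors of the n×m matrix `M`, with singular
values `s` (padded, decreasing, nonnegative). -/
def IsTopLeftSingular {n m k : ℕ} (hkn : k ≤ n) (M : Matrix (Fin n) (Fin m) ℝ)
    (s : Fin n → ℝ) (U : Matrix (Fin n) (Fin k) ℝ) : Prop :=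
  ∃ (W : Matrix (Fin n) (Fin n) ℝ) (V : Matrix (Fin m) (Fin m) ℝ),
    Wᵀ * W = 1 ∧ Vᵀ * V = 1 ∧ (∀ i j : Fin n, i ≤ j → s j ≤ s i) ∧ (∀ i, 0 ≤ s i) ∧
    M = W * (Matrix.of fun (i : Fin n) (j : Fin m) => if (i : ℕ) = (j : ℕ) then s i else 0) * Vᵀ ∧
    (U = Matrix.of fun i j => W i (Fin.castLE hkn j))

/-- iid centered Gaussian matrix measure with variance v per entry. -/
noncomputable def gaussPi (n m : ℕ) (v : NNReal) : Measure (Fin n → Fin m → ℝ) :=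
  Measure.pi fun _ => Measure.pi fun _ => gaussianReal 0 v

end

noncomputable section

/-- Total weight of the ways to extend by `k` steps a walk in which `s` edges were used once and `d`
edges at least twice, when each step takes one of `N` new edges or any old edge. A completed walk
has weight `0` if some edge is used exactly once, and `v` to the number of its edges otherwise. -/
noncomputable def walkWeight (N v : ℝ) : ℕ → ℕ → ℕ → ℝ
  | 0, s, d => if s = 0 then v ^ d else 0
  | k + 1, s, d => N * walkWeight N v k (s + 1) d + s * walkWeight N v k (s - 1) (d + 1)
      + d * walkWeight N v k s d

lemma walkWeight_nonneg {N v : ℝ} (hN : 0 ≤ N) (hv : 0 ≤ v) (k s d : ℕ) :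
    0 ≤ walkWeight N v k s d := by
  induction k generalizing s d with
  | zero => rw [walkWeight]; split_ifs <;> positivity
  | succ k ih =>
    rw [walkWeight]
    have h₁ := ih (s + 1) d
    have h₂ := ih (s - 1) (d + 1)
    have h₃ := ih s d
    positivity

/-- Closed form of the exponential generating function of `k ↦ walkWeight N v k s d`. -/
noncomputable def walkGen (N v : ℝ) (s d : ℕ) (θ : ℝ) : ℝ :=
  v ^ (s + d) * Real.exp θ ^ d * (Real.exp θ - 1) ^ s * Real.exp (N * v * (Real.exp θ - 1 - θ))

lemma walkGen_nonneg {N v : ℝ} (hv : 0 ≤ v) (s d : ℕ) {θ : ℝ} (hθ : 0 ≤ θ) :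
    0 ≤ walkGen N v s d θ := by
  have : 0 ≤ Real.exp θ - 1 := by linarith [Real.one_le_exp hθ]
  unfold walkGen
  positivity

lemma hasDerivAt_walkGen (N v : ℝ) (s d : ℕ) (θ : ℝ) :
    HasDerivAt (walkGen N v s d)
      (N * walkGen N v (s + 1) d θ + s * walkGen N v (s - 1) (d + 1) θ + d * walkGen N v s d θ)
      θ := by
  have he := Real.hasDerivAt_exp θ
  have h := (((he.pow d).const_mul (v ^ (s + d))).mul ((he.sub_const 1).pow s)).mul
    ((((he.sub_const 1).sub (hasDerivAt_id θ)).const_mul (N * v)).exp)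
  refine h.congr_deriv ?_
  simp only [walkGen, Pi.mul_apply, Pi.pow_apply, Pi.sub_apply, id]
  rcases s with _ | s <;> rcases d with _ | d <;> simp <;> ring

lemma sum_walkWeight_le {N v : ℝ} (hN : 0 ≤ N) (hv : 0 ≤ v) (K s d : ℕ) {θ : ℝ} (hθ : 0 ≤ θ) :
    ∑ k ∈ Finset.range K, walkWeight N v k s d * (θ ^ k / k.factorial) ≤ walkGen N v s d θ := by
  induction K generalizing s d θ with
  | zero => simpa using walkGen_nonneg hv s d hθ
  | succ K ih =>
    have hf (x : ℝ) : HasDerivAt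
        (fun x => ∑ k ∈ Finset.range (K + 1), walkWeight N v k s d * (x ^ k / k.factorial))
        (∑ k ∈ Finset.range K, walkWeight N v (k + 1) s d * (x ^ k / k.factorial)) x := by
      have h := HasDerivAt.fun_sum (u := Finset.range (K + 1)) fun k _ =>
        ((hasDerivAt_pow k x).div_const (k.factorial : ℝ)).const_mul (walkWeight N v k s d)
      refine h.congr_deriv ?_
      rw [Finset.sum_range_succ']
      simp only [Nat.cast_zero, zero_mul, zero_div, mul_zero, add_zero, Nat.add_sub_cancel]
      refine Finset.sum_congr rfl fun k _ => ?_
      rw [Nat.factorial_succ]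
      have : (k.factorial : ℝ) ≠ 0 := by positivity
      push_cast
      field_simp
    refine image_le_of_deriv_right_le_deriv_boundary (a := 0) (b := θ)
      (fun x _ => (hf x).continuousAt.continuousWithinAt)
      (fun x _ => (hf x).hasDerivWithinAt) ?_
      (fun x _ => (hasDerivAt_walkGen N v s d x).continuousAt.continuousWithinAt)
      (fun x _ => (hasDerivAt_walkGen N v s d x).hasDerivWithinAt) ?_
      (Set.right_mem_Icc.2 hθ)
    · rw [Finset.sum_range_succ']
      rcases s with _ | s <;> simp [walkGen, walkWeight]
    · intro x hx
      have h₁ := mul_le_mul_of_nonneg_left (ih (s + 1) d hx.1) hN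
      have h₂ := mul_le_mul_of_nonneg_left (ih (s - 1) (d + 1) hx.1) (Nat.cast_nonneg (α := ℝ) s)
      have h₃ := mul_le_mul_of_nonneg_left (ih s d hx.1) (Nat.cast_nonneg (α := ℝ) d)
      refine le_trans (le_of_eq ?_) (add_le_add (add_le_add h₁ h₂) h₃)
      simp only [Finset.mul_sum, ← Finset.sum_add_distrib, walkWeight]
      exact Finset.sum_congr rfl fun k _ => by ring

lemma exp_sub_one_sub_le {θ : ℝ} (hθ : 0 ≤ θ) :
    (1 - θ / 3) * (Real.exp θ - 1 - θ) ≤ θ ^ 2 / 2 := by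
  have hd (x : ℝ) := Real.hasDerivAt_exp x
  have hf (x : ℝ) : HasDerivAt (fun x : ℝ => (1 - x / 3) * (Real.exp x - 1 - x))
      (-(1 / 3) * (Real.exp x - 1 - x) + (1 - x / 3) * (Real.exp x - 1)) x := by
    refine ((((hasDerivAt_id x).div_const 3).const_sub 1).mul
      (((hd x).sub_const 1).sub (hasDerivAt_id x))).congr_deriv ?_
    simp

  have hg (x : ℝ) : HasDerivAt
      (fun x : ℝ => -(1 / 3) * (Real.exp x - 1 - x) + (1 - x / 3) * (Real.exp x - 1))
      (-(1 / 3) * (Real.exp x - 1) + (-(1 / 3) * (Real.exp x - 1) + (1 - x / 3) * Real.exp x)) x := by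
    refine (((((hd x).sub_const 1).sub (hasDerivAt_id x)).const_mul (-(1 / 3) : ℝ)).add
      ((((hasDerivAt_id x).div_const 3).const_sub 1).mul ((hd x).sub_const 1))).congr_deriv ?_
    simp

  have hg_le {y : ℝ} (hy : 0 ≤ y) :
      -(1 / 3) * (Real.exp y - 1 - y) + (1 - y / 3) * (Real.exp y - 1) ≤ y := by
    refine image_le_of_deriv_right_le_deriv_boundary (a := 0) (b := y) (B := fun x => x)
      (fun x _ => (hg x).continuousAt.continuousWithinAt)
      (fun x _ => (hg x).hasDerivWithinAt) (by simp)
      continuousOn_id (fun x _ => (hasDerivAt_id x).hasDerivWithinAt) ?_ (Set.right_mem_Icc.2 hy)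
    intro x _
    have h₁ : (1 - x) * Real.exp x ≤ 1 := by
      have h₂ := Real.add_one_le_exp (-x)
      calc (1 - x) * Real.exp x ≤ Real.exp (-x) * Real.exp x := by gcongr; linarith
        _ = 1 := by rw [← Real.exp_add]; simp
    nlinarith
  refine image_le_of_deriv_right_le_deriv_boundary (a := 0) (b := θ) (B := fun x => x ^ 2 / 2)
    (B' := fun x => x)
    (fun x _ => (hf x).continuousAt.continuousWithinAt)
    (fun x _ => (hf x).hasDerivWithinAt) (by simp) (by fun_prop)
    (fun x _ => ?_) (fun x hx => hg_le hx.1) (Set.right_mem_Icc.2 hθ)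
  exact (((hasDerivAt_pow 2 x).div_const 2).congr_deriv (by simp)).hasDerivWithinAt

/-- The optimal exponent for the sub-gamma Chernoff bound with variance `V` and scale `1 / 3`. -/
lemma exists_chernoff_exponent {V L : ℝ} (hV : 0 ≤ V) (hL : 0 < L) :
    ∃ θ : ℝ, 0 ≤ θ ∧
      V * (Real.exp θ - 1 - θ) - θ * (Real.sqrt (2 * V * L) + 1 / 3 * L) ≤ -L := by
  rcases hV.eq_or_lt with rfl | hV
  · exact ⟨3, by norm_num, by simp⟩
  set s := Real.sqrt (2 * L / V) with hs
  have hs0 : 0 < s := Real.sqrt_pos.2 (by positivity)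
  have hs2 : V * s ^ 2 = 2 * L := by
    rw [hs, Real.sq_sqrt (by positivity)]; field_simp
  have hsq : Real.sqrt (2 * V * L) = V * s := by
    rw [Real.sqrt_eq_iff_mul_self_eq (by positivity) (by positivity)]; nlinarith
  refine ⟨s / (1 + s / 3), by positivity, ?_⟩
  have h := exp_sub_one_sub_le (θ := s / (1 + s / 3)) (by positivity)
  rw [hsq]
  have h1 : 1 - s / (1 + s / 3) / 3 = 1 / (1 + s / 3) := by field_simp; ring
  rw [h1] at h
  have h2 : Real.exp (s / (1 + s / 3)) - 1 - s / (1 + s / 3) ≤ s ^ 2 / (2 * (1 + s / 3)) := by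
    rw [one_div, inv_mul_le_iff₀ (by positivity)] at h
    refine h.trans (le_of_eq ?_)
    field_simp
  have h3 := mul_le_mul_of_nonneg_left h2 hV.le
  have h4 : V * (s ^ 2 / (2 * (1 + s / 3))) - s / (1 + s / 3) * (V * s + 1 / 3 * L) = -L := by
    have : L = V * s ^ 2 / 2 := by linarith
    rw [this]
    field_simp
    ring
  linarith

section
open scoped Matrix.Norms.L2Operator

lemma specNorm_pow_le_trace {n : ℕ} (M : Matrix (Fin n) (Fin n) ℝ) (hM : M.IsSymm) (hn : 0 < n)
    (k : ℕ) : specNorm M ^ (2 * k) ≤ (M ^ (2 * k)).trace := by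
  have : Nonempty (Fin n) := ⟨⟨0, hn⟩⟩
  have hH : M.IsHermitian := by
    rw [Matrix.IsHermitian, Matrix.conjTranspose_eq_transpose_of_trivial]; exact hM
  have hnorm : specNorm M = ‖hH.eigenvalues‖ := by
    change ‖M‖ = _
    conv_lhs => rw [hH.spectral_theorem, Unitary.conjStarAlgAut_apply,
      ← Unitary.coe_star, CStarRing.norm_mul_coe_unitary, CStarRing.norm_coe_unitary_mul]
    rw [Matrix.l2_opNorm_diagonal]
    rfl
  obtain ⟨i, hi⟩ := Finite.exists_max fun i => |hH.eigenvalues i|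
  have htrace : (M ^ (2 * k)).trace = ∑ j, hH.eigenvalues j ^ (2 * k) := by
    conv_lhs => rw [hH.spectral_theorem, ← map_pow, Unitary.conjStarAlgAut_apply,
      Matrix.trace_mul_cycle, Unitary.coe_star_mul_self, one_mul, Matrix.diagonal_pow,
      Matrix.trace_diagonal]
    rfl
  have hle : specNorm M ≤ |hH.eigenvalues i| := by
    rw [hnorm]
    exact (pi_norm_le_iff_of_nonneg (abs_nonneg _)).2 hi
  calc specNorm M ^ (2 * k) ≤ |hH.eigenvalues i| ^ (2 * k) := by
        gcongr; exact norm_nonneg _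
    _ = hH.eigenvalues i ^ (2 * k) := by rw [pow_mul, sq_abs, ← pow_mul]
    _ ≤ ∑ j, hH.eigenvalues j ^ (2 * k) :=
        Finset.single_le_sum (f := fun j => hH.eigenvalues j ^ (2 * k)) (fun j _ => (even_two_mul k).pow_nonneg _) (Finset.mem_univ i)
    _ = _ := htrace.symm
end

section
variable {n : ℕ}

/-- Centered randomized-response noise on the pair `p`, as a function of the flip. -/
def flipNoise (μ : ℝ) (A : Matrix (Fin n) (Fin n) ℝ) (p : Fin n × Fin n) (b : Bool) : ℝ :=
  (1 - 2 * A p.1 p.2) * ((if b then 1 else 0) - μ)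

/-- The pair `{i, j}` listed in increasing order. -/
def sortedPair (i j : Fin n) : Fin n × Fin n := (min i j, max i j)

lemma sortedPair_injective (i : Fin n) : Function.Injective (sortedPair i) := by
  intro j j' h
  simp only [sortedPair, Prod.mk.injEq] at h
  rcases le_total i j with h₁ | h₁ <;> rcases le_total i j' with h₂ | h₂ <;> simp_all

lemma applyRR_sub_apply (μ : ℝ) {A : Matrix (Fin n) (Fin n) ℝ} (hA : IsAdj A)
    (f : Fin n → Fin n → Bool) (i j : Fin n) :
    (applyRR A f - ((1 - 2 * μ) • A +
        μ • (Matrix.of fun i j => if i = j then (0 : ℝ) else 1)) : Matrix (Fin n) (Fin n) ℝ) i j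
      = if i = j then 0 else
        flipNoise μ A (sortedPair i j) (f (sortedPair i j).1 (sortedPair i j).2) := by
  have hs : A j i = A i j := hA.2.1.apply i j
  rcases lt_trichotomy i j with h | rfl | h
  · cases hf : f i j <;>
      simp [applyRR, flipNoise, sortedPair, h.ne, h, h.le, hf] <;> ring
  · simp [applyRR, hA.2.2 i]
  · cases hf : f j i <;>
      simp [applyRR, flipNoise, sortedPair, h.ne', h.not_gt, h.le, hf, hs] <;> ring

lemma isProbabilityMeasure_bernBool {μ : ℝ} (h₀ : 0 ≤ μ) (h₁ : μ ≤ 1) :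
    IsProbabilityMeasure (bernBool μ) := by
  constructor
  simp [bernBool, ← ENNReal.ofReal_add h₀ (sub_nonneg.2 h₁)]

lemma integral_bernBool {μ : ℝ} (h₀ : 0 ≤ μ) (h₁ : μ ≤ 1) (g : Bool → ℝ) :
    ∫ b, g b ∂bernBool μ = μ * g true + (1 - μ) * g false := by
  have h (a : ℝ) (b : Bool) : IsFiniteMeasure (ENNReal.ofReal a • Measure.dirac b) :=
    Measure.smul_finite _ ENNReal.ofReal_ne_top
  rw [bernBool, integral_add_measure .of_finite .of_finite, integral_smul_measure,
    integral_smul_measure, integral_dirac, integral_dirac]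
  simp [ENNReal.toReal_ofReal h₀, ENNReal.toReal_ofReal (sub_nonneg.2 h₁)]

/-- Bound for the `k`-th moment of a centered Bernoulli variable of variance `v`. -/
def momentBound (v : ℝ) (k : ℕ) : ℝ := if k = 0 then 1 else if k = 1 then 0 else v

lemma abs_integral_flipNoise_pow_le {μ : ℝ} (h₀ : 0 ≤ μ) (h₁ : μ ≤ 1)
    {A : Matrix (Fin n) (Fin n) ℝ} (hA : IsAdj A) (p : Fin n × Fin n) (k : ℕ) :
    |∫ b, flipNoise μ A p b ^ k ∂bernBool μ| ≤ momentBound (μ * (1 - μ)) k := by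
  have hsign : |1 - 2 * A p.1 p.2| = 1 := by
    rcases hA.1 p.1 p.2 with h | h <;> norm_num [h]
  have h₁' : 0 ≤ 1 - μ := sub_nonneg.2 h₁
  rw [integral_bernBool h₀ h₁]
  rcases k with _ | _ | k
  · simp [momentBound]
  · simp [momentBound, flipNoise]
    ring
  · simp only [momentBound, flipNoise, mul_pow]
    have hx : μ ^ (k + 1) ≤ μ := pow_le_of_le_one h₀ h₁ (by simp)
    have hy : (1 - μ) ^ (k + 1) ≤ 1 - μ := pow_le_of_le_one h₁' (by linarith) (by simp)
    refine (abs_add_le _ _).trans ?_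
    simp only [abs_mul, abs_pow, hsign, one_pow, one_mul, abs_of_nonneg h₀, abs_of_nonneg h₁']
    simp only [if_true, Bool.false_eq_true, if_false, zero_sub, abs_neg, abs_of_nonneg h₀,
      abs_of_nonneg h₁']
    simp
    calc μ * (1 - μ) ^ (k + 1 + 1) + (1 - μ) * μ ^ (k + 1 + 1)
        = μ * (1 - μ) * ((1 - μ) ^ (k + 1) + μ ^ (k + 1)) := by ring
      _ ≤ μ * (1 - μ) * 1 := by
        refine mul_le_mul_of_nonneg_left (by linarith) (by positivity)
      _ = _ := mul_one _

instance isProbabilityMeasure_flipPi {μ : ℝ} [IsProbabilityMeasure (bernBool μ)] :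
    IsProbabilityMeasure (flipPi n μ) := by
  unfold flipPi; infer_instance

lemma integral_flipPi_prod {μ : ℝ} [IsProbabilityMeasure (bernBool μ)]
    (g : Fin n × Fin n → Bool → ℝ) :
    ∫ f, ∏ p : Fin n × Fin n, g p (f p.1 p.2) ∂flipPi n μ = ∏ p, ∫ b, g p b ∂bernBool μ := by
  simp_rw [Fintype.prod_prod_type, flipPi]
  rw [integral_fintype_prod_eq_prod fun i (r : Fin n → Bool) => ∏ j, g (i, j) (r j)]
  exact Finset.prod_congr rfl fun i _ => integral_fintype_prod_eq_prod fun j b => g (i, j) b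

/-- Number of coordinates at which `m` equals one. -/
def numOnce (m : Fin n × Fin n → ℕ) : ℕ := (Finset.univ.filter fun p => m p = 1).card

/-- Number of coordinates at which `m` is at least two. -/
def numRepeated (m : Fin n × Fin n → ℕ) : ℕ := (Finset.univ.filter fun p => 2 ≤ m p).card

lemma prod_momentBound (v : ℝ) (m : Fin n × Fin n → ℕ) :
    ∏ p, momentBound v (m p) = if numOnce m = 0 then v ^ numRepeated m else 0 := by
  split_ifs with h
  · rw [numRepeated, ← Finset.prod_const, Finset.prod_filter]
    refine Finset.prod_congr rfl fun p _ => ?_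
    have hp : m p ≠ 1 := by
      intro hp
      rw [numOnce, Finset.card_eq_zero] at h
      simpa [h] using (Finset.mem_filter.2 ⟨Finset.mem_univ p, hp⟩ :
        p ∈ Finset.univ.filter fun p => m p = 1)
    rcases h2 : m p with _ | _ | k
    · simp [momentBound]
    · exact absurd h2 hp
    · simp [momentBound]
  · obtain ⟨p, hp⟩ := Finset.card_ne_zero.1 h
    refine Finset.prod_eq_zero (Finset.mem_univ p) ?_
    simp [momentBound, (Finset.mem_filter.1 hp).2]

lemma walkWeight_update {N v : ℝ} (k : ℕ) (m : Fin n × Fin n → ℕ) (e : Fin n × Fin n) :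
    walkWeight N v k (numOnce (Function.update m e (m e + 1)))
        (numRepeated (Function.update m e (m e + 1))) =
      (if m e = 0 then walkWeight N v k (numOnce m + 1) (numRepeated m) else 0)
      + (if m e = 1 then walkWeight N v k (numOnce m - 1) (numRepeated m + 1) else 0)
      + (if 2 ≤ m e then walkWeight N v k (numOnce m) (numRepeated m) else 0) := by
  rcases he : m e with _ | _ | a
  · have h1 : numOnce (Function.update m e (0 + 1)) = numOnce m + 1 := by
      rw [numOnce, numOnce, ← Finset.card_insert_of_notMem (a := e) (by simp [he])]
      congr 1; ext p
      by_cases h : p = e <;> simp [Function.update_apply, h]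
    have h2 : numRepeated (Function.update m e (0 + 1)) = numRepeated m := by
      rw [numRepeated, numRepeated]
      congr 1; ext p
      by_cases h : p = e <;> simp [Function.update_apply, h, he]
    simp [h1, h2]
  · have h1 : numOnce (Function.update m e (0 + 1 + 1)) = numOnce m - 1 := by
      rw [numOnce, numOnce, ← Finset.card_erase_of_mem (a := e) (by simp [he])]
      congr 1; ext p
      by_cases h : p = e <;> simp [Function.update_apply, h]
    have h2 : numRepeated (Function.update m e (0 + 1 + 1)) = numRepeated m + 1 := by
      rw [numRepeated, numRepeated, ← Finset.card_insert_of_notMem (a := e) (by simp [he])]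
      congr 1; ext p
      by_cases h : p = e <;> simp [Function.update_apply, h]
    simp [h1, h2]
  · have h1 : numOnce (Function.update m e (a + 1 + 1 + 1)) = numOnce m := by
      rw [numOnce, numOnce]
      congr 1; ext p
      by_cases h : p = e <;> simp [Function.update_apply, h, he]
    have h2 : numRepeated (Function.update m e (a + 1 + 1 + 1)) = numRepeated m := by
      rw [numRepeated, numRepeated]
      congr 1; ext p
      by_cases h : p = e <;> simp [Function.update_apply, h, he]
    simp [h1, h2]

lemma sum_walkWeight_update_le {N v : ℝ} (hN : 0 ≤ N) (hv : 0 ≤ v) (hn : (n : ℝ) - 1 ≤ N) (k : ℕ)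
    (m : Fin n × Fin n → ℕ) (i : Fin n) :
    ∑ j ∈ Finset.univ.erase i,
        walkWeight N v k
          (numOnce (Function.update m (sortedPair i j) (m (sortedPair i j) + 1)))
          (numRepeated (Function.update m (sortedPair i j) (m (sortedPair i j) + 1))) ≤
      walkWeight N v (k + 1) (numOnce m) (numRepeated m) := by
  have hcount (P : ℕ → Prop) [DecidablePred P] :
      ((Finset.univ.erase i).filter fun j => P (m (sortedPair i j))).card ≤
        (Finset.univ.filter fun p => P (m p)).card := by
    refine Finset.card_le_card_of_injOn (sortedPair i) ?_ (sortedPair_injective i).injOn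
    intro j hj
    simpa using (Finset.mem_filter.1 hj).2
  simp only [walkWeight_update, Finset.sum_add_distrib, ← Finset.sum_filter, Finset.sum_const,
    nsmul_eq_mul]
  rw [walkWeight]
  have h₀ : (((Finset.univ.erase i).filter fun j => m (sortedPair i j) = 0).card : ℝ) ≤ N := by
    refine le_trans ?_ hn
    have h := (Finset.card_filter_le (Finset.univ.erase i) fun j => m (sortedPair i j) = 0)
    rw [Finset.card_erase_of_mem (Finset.mem_univ i), Finset.card_univ, Fintype.card_fin] at h
    have h' : (((Finset.univ.erase i).filter fun j => m (sortedPair i j) = 0).card : ℝ) + 1 ≤ n := by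
      have := i.pos
      exact_mod_cast (by omega : _ + 1 ≤ n)
    linarith
  gcongr
  · exact walkWeight_nonneg hN hv _ _ _
  · exact walkWeight_nonneg hN hv _ _ _
  · exact hcount fun a => a = 1
  · exact walkWeight_nonneg hN hv _ _ _
  · exact hcount fun a => 2 ≤ a

lemma abs_integral_prod_mul_pow_le {μ : ℝ} (h₀ : 0 ≤ μ) (h₁ : μ ≤ 1)
    {A : Matrix (Fin n) (Fin n) ℝ} (hA : IsAdj A)
    {Z : (Fin n → Fin n → Bool) → Matrix (Fin n) (Fin n) ℝ}
    (hZ : ∀ f i j, Z f i j = if i = j then 0 else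
      flipNoise μ A (sortedPair i j) (f (sortedPair i j).1 (sortedPair i j).2))
    {N : ℝ} (hN : 0 ≤ N) (hn : (n : ℝ) - 1 ≤ N)
    (k : ℕ) (i l : Fin n) (m : Fin n × Fin n → ℕ) :
    |∫ f, (∏ p, flipNoise μ A p (f p.1 p.2) ^ m p) * (Z f ^ k) i l ∂flipPi n μ| ≤
      walkWeight N (μ * (1 - μ)) k (numOnce m) (numRepeated m) := by
  have := isProbabilityMeasure_bernBool h₀ h₁
  have hv : 0 ≤ μ * (1 - μ) := mul_nonneg h₀ (sub_nonneg.2 h₁)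
  induction k generalizing i m with
  | zero =>
    rw [walkWeight, ← prod_momentBound]
    simp only [pow_zero]
    rw [integral_mul_const, integral_flipPi_prod fun p b => flipNoise μ A p b ^ m p, abs_mul,
      Finset.abs_prod]
    have hle : ∏ p, |∫ b, flipNoise μ A p b ^ m p ∂bernBool μ| ≤
        ∏ p, momentBound (μ * (1 - μ)) (m p) :=
      Finset.prod_le_prod (fun _ _ => abs_nonneg _)
        fun p _ => abs_integral_flipNoise_pow_le h₀ h₁ hA p (m p)
    refine le_trans (mul_le_of_le_one_right (Finset.prod_nonneg fun _ _ => abs_nonneg _) ?_) hle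
    rw [Matrix.one_apply]
    split_ifs <;> simp
  | succ k ih =>
    have hstep (f : Fin n → Fin n → Bool) :
        (∏ p, flipNoise μ A p (f p.1 p.2) ^ m p) * (Z f ^ (k + 1)) i l =
          ∑ j ∈ Finset.univ.erase i, (∏ p, flipNoise μ A p (f p.1 p.2) ^
            Function.update m (sortedPair i j) (m (sortedPair i j) + 1) p) * (Z f ^ k) j l := by
      rw [pow_succ', Matrix.mul_apply, Finset.mul_sum, ← Finset.sum_erase _ (a := i)
        (by simp [hZ])]
      refine Finset.sum_congr rfl fun j hj => ?_
      rw [hZ, if_neg (Finset.ne_of_mem_erase hj).symm, ← mul_assoc]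
      congr 1
      rw [← Finset.mul_prod_erase _ _ (Finset.mem_univ (sortedPair i j)),
        ← Finset.mul_prod_erase Finset.univ (fun p => flipNoise μ A p (f p.1 p.2) ^
            Function.update m (sortedPair i j) (m (sortedPair i j) + 1) p)
          (Finset.mem_univ (sortedPair i j)), Function.update_self, pow_succ, mul_right_comm]
      congr 1
      refine Finset.prod_congr rfl fun p hp => ?_
      rw [Function.update_of_ne (Finset.ne_of_mem_erase hp)]
    simp_rw [hstep]
    rw [integral_finsetSum _ fun j _ => .of_finite]
    refine (Finset.abs_sum_le_sum_abs _ _).trans ?_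
    refine (Finset.sum_le_sum fun j _ => ih j _).trans ?_
    exact sum_walkWeight_update_le hN hv hn k m i

/-- The trace moments of the noise matrix are at most those of weighted walks. -/
lemma integral_trace_pow_le {μ : ℝ} (h₀ : 0 ≤ μ) (h₁ : μ ≤ 1)
    {A : Matrix (Fin n) (Fin n) ℝ} (hA : IsAdj A)
    {Z : (Fin n → Fin n → Bool) → Matrix (Fin n) (Fin n) ℝ}
    (hZ : ∀ f i j, Z f i j = if i = j then 0 else
      flipNoise μ A (sortedPair i j) (f (sortedPair i j).1 (sortedPair i j).2))
    {N : ℝ} (hN : 0 ≤ N) (hn : (n : ℝ) - 1 ≤ N) (k : ℕ) :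
    ∫ f, (Z f ^ k).trace ∂flipPi n μ ≤ n * walkWeight N (μ * (1 - μ)) k 0 0 := by
  have := isProbabilityMeasure_bernBool h₀ h₁
  simp only [Matrix.trace, Matrix.diag_apply]
  rw [integral_finsetSum _ fun j _ => .of_finite]
  calc _ ≤ ∑ _i : Fin n, walkWeight N (μ * (1 - μ)) k 0 0 := by
        refine Finset.sum_le_sum fun i _ => ?_
        have h := abs_integral_prod_mul_pow_le h₀ h₁ hA hZ hN hn k i i 0
        simp only [Pi.zero_apply, pow_zero, Finset.prod_const_one, one_mul] at h
        exact (le_abs_self _).trans (by simpa [numOnce, numRepeated] using h)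
    _ = _ := by simp

lemma integral_cosh_specNorm_le {μ : ℝ} (h₀ : 0 ≤ μ) (h₁ : μ ≤ 1)
    {A : Matrix (Fin n) (Fin n) ℝ} (hA : IsAdj A)
    {Z : (Fin n → Fin n → Bool) → Matrix (Fin n) (Fin n) ℝ}
    (hZ : ∀ f i j, Z f i j = if i = j then 0 else
      flipNoise μ A (sortedPair i j) (f (sortedPair i j).1 (sortedPair i j).2))
    (hn : 0 < n) {θ : ℝ} (hθ : 0 ≤ θ) :
    ∫ f, Real.cosh (θ * specNorm (Z f)) ∂flipPi n μ ≤
      n * Real.exp (((n : ℝ) - 1) * (μ * (1 - μ)) * (Real.exp θ - 1 - θ)) := by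
  have := isProbabilityMeasure_bernBool h₀ h₁
  have hv : 0 ≤ μ * (1 - μ) := mul_nonneg h₀ (sub_nonneg.2 h₁)
  have hN : (0 : ℝ) ≤ n - 1 := by
    have : (1 : ℝ) ≤ n := by exact_mod_cast hn
    linarith
  have hsymm (f) : (Z f).IsSymm := by
    ext i j
    rw [Matrix.transpose_apply, hZ, hZ]
    simp only [sortedPair, min_comm i j, max_comm i j, eq_comm (a := i)]
  have hsum : HasSum (fun k => ∫ f, (θ * specNorm (Z f)) ^ (2 * k) / (2 * k).factorial ∂flipPi n μ)
      (∫ f, Real.cosh (θ * specNorm (Z f)) ∂flipPi n μ) := by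
    simp_rw [integral_fintype Integrable.of_finite]
    exact hasSum_sum fun f _ => (Real.hasSum_cosh _).const_smul _
  refine le_of_tendsto hsum.tendsto_sum_nat (Filter.Eventually.of_forall fun K => ?_)
  calc _ ≤ ∑ k ∈ Finset.range K, n * (walkWeight (n - 1) (μ * (1 - μ)) (2 * k) 0 0 *
          (θ ^ (2 * k) / (2 * k).factorial)) := by
        refine Finset.sum_le_sum fun k _ => ?_
        calc _ ≤ ∫ f, (θ ^ (2 * k) / (2 * k).factorial) * (Z f ^ (2 * k)).trace ∂flipPi n μ := by
              refine integral_mono .of_finite .of_finite fun f => ?_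
              change (θ * specNorm (Z f)) ^ (2 * k) / _ ≤ _
              rw [mul_pow, mul_div_right_comm]
              gcongr
              exact specNorm_pow_le_trace _ (hsymm f) hn k
          _ ≤ (θ ^ (2 * k) / (2 * k).factorial) *
                (n * walkWeight (n - 1) (μ * (1 - μ)) (2 * k) 0 0) := by
              rw [integral_const_mul]
              gcongr
              exact integral_trace_pow_le h₀ h₁ hA hZ hN le_rfl _
          _ = _ := by ring
    _ = n * ∑ k ∈ (Finset.range K).image (2 * ·), walkWeight (n - 1) (μ * (1 - μ)) k 0 0 *
          (θ ^ k / k.factorial) := by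
        rw [Finset.sum_image (by intro a _ b _ h; simpa using h), Finset.mul_sum]
    _ ≤ n * ∑ k ∈ Finset.range (2 * K), walkWeight (n - 1) (μ * (1 - μ)) k 0 0 *
          (θ ^ k / k.factorial) := by
        refine mul_le_mul_of_nonneg_left ?_ n.cast_nonneg
        refine Finset.sum_le_sum_of_subset_of_nonneg ?_ fun k _ _ =>
          mul_nonneg (walkWeight_nonneg hN hv _ _ _) (by positivity)
        intro k
        simp only [Finset.mem_image, Finset.mem_range]
        omega
    _ ≤ n * walkGen (n - 1) (μ * (1 - μ)) 0 0 θ := by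
        gcongr
        exact sum_walkWeight_le hN hv _ _ _ hθ
    _ = _ := by simp [walkGen]

end

/-- Bounding the spectral norm of Z: with probability at least `1−η`
over the randomized-response flips, the centered noise matrix `Z = Ã − E[Ã|A]` satisfies
`‖Z‖₂ ≤ √(2(n−1) v_max log(2n/η)) + (1/3) log(2n/η)` with `v_max = μ(1−μ)`. -/
theorem rr_noise_spectral_norm {n : ℕ} (μ : ℝ) (hμ0 : 0 ≤ μ) (hμ : μ < 1/2)
    (A : Matrix (Fin n) (Fin n) ℝ) (hA : IsAdj A)
    (Z : (Fin n → Fin n → Bool) → Matrix (Fin n) (Fin n) ℝ)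
    (hZ : ∀ f, Z f = applyRR A f -
      ((1 - 2*μ) • A + μ • (Matrix.of fun i j => if i = j then (0:ℝ) else 1)))
    (η : ℝ) (hη0 : 0 < η) (hη1 : η < 1) :
    ENNReal.ofReal (1 - η) ≤
      flipPi n μ {f | specNorm (Z f) ≤
        Real.sqrt (2 * ((n : ℝ) - 1) * (μ * (1 - μ)) * Real.log (2 * n / η)) +
          (1/3) * Real.log (2 * n / η)} := by
  have h₁ : μ ≤ 1 := by linarith
  have := isProbabilityMeasure_bernBool hμ0 h₁
  rcases Nat.eq_zero_or_pos n with rfl | hn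
  · have hnorm (f) : specNorm (Z f) = 0 := by
      rw [Subsingleton.elim (Z f) 0]
      simp [specNorm]
    simp [hnorm, hη0.le]
  have hn' : (1 : ℝ) ≤ n := by exact_mod_cast hn
  have hZ' (f i j) : Z f i j = if i = j then 0 else
      flipNoise μ A (sortedPair i j) (f (sortedPair i j).1 (sortedPair i j).2) := by
    rw [hZ, applyRR_sub_apply μ hA]
  have hL : 0 < Real.log (2 * n / η) :=
    Real.log_pos ((one_lt_div hη0).2 (by linarith))
  set L := Real.log (2 * n / η) with hLdef
  obtain ⟨θ, hθ, hexp⟩ := exists_chernoff_exponent (V := ((n : ℝ) - 1) * (μ * (1 - μ)))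
    (mul_nonneg (by linarith) (mul_nonneg hμ0 (by linarith))) hL
  rw [← mul_assoc 2] at hexp
  set t := Real.sqrt (2 * ((n : ℝ) - 1) * (μ * (1 - μ)) * L) + 1 / 3 * L with ht
  have htail : (flipPi n μ).real {f | specNorm (Z f) ≤ t}ᶜ ≤ η := by
    have hmarkov := mul_meas_ge_le_integral_of_nonneg (μ := flipPi n μ)
      (f := fun f => Real.cosh (θ * specNorm (Z f)))
      (Filter.Eventually.of_forall fun f => (Real.cosh_pos _).le) .of_finite
      (Real.exp (θ * t) / 2)
    have hsub : (flipPi n μ).real {f | specNorm (Z f) ≤ t}ᶜ ≤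
        (flipPi n μ).real {f | Real.exp (θ * t) / 2 ≤ Real.cosh (θ * specNorm (Z f))} := by
      refine measureReal_mono fun f hf => ?_
      have hf' : t < specNorm (Z f) := not_le.1 hf
      have h₂ : Real.exp (θ * t) ≤ Real.exp (θ * specNorm (Z f)) := by gcongr
      rw [Set.mem_ofPred_eq, Real.cosh_eq]
      linarith [Real.exp_pos (-(θ * specNorm (Z f)))]
    have hbound := hmarkov.trans (integral_cosh_specNorm_le hμ0 h₁ hA hZ' hn hθ)
    have hηL : η = 2 * n * Real.exp (-L) := by
      rw [Real.exp_neg, hLdef, Real.exp_log (by positivity)]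
      field_simp
    refine hsub.trans ?_
    rw [← le_div_iff₀' (by positivity)] at hbound
    refine hbound.trans ?_
    rw [hηL, div_le_iff₀ (by positivity)]
    have hE : Real.exp (((n : ℝ) - 1) * (μ * (1 - μ)) * (Real.exp θ - 1 - θ)) ≤
        Real.exp (-L) * Real.exp (θ * t) := by
      rw [← Real.exp_add]
      gcongr
      linarith
    calc _ ≤ n * (Real.exp (-L) * Real.exp (θ * t)) := by gcongr
      _ = _ := by ring
  rw [← ofReal_measureReal]
  refine ENNReal.ofReal_le_ofReal ?_
  rw [probReal_compl_eq_one_sub (Set.toFinite _).measurableSet] at htail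
  linarith

end
end

section
/- Let A ∈ ℝ^{n×n} be symmetric with eigenvalues λ₁(A) ≥ ⋯ ≥ λ_n(A), and let Ã = A + Z with Z symmetric. Let U ∈ ℝ^{n×k} and Ũ ∈ ℝ^{n×k} be column-orthonormal matrices whose columns are eigenvectors of A and Ã associated with their k largest eigenvalues, respectively. If the eigengap Δ_k = λ_k(A) − λ_{k+1}(A) is positive and ‖Z‖₂ ≤ (1 − 1/√2)·Δ_k, then dist(U, Ũ) ≤ 2·‖Z‖₂ / Δ_k. -/
open MeasureTheory ProbabilityTheory Matrix
open scoped ENNReal NNReal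

set_option autoImplicit false

noncomputable section

theorem dotProduct_mulVec_le_specNorm {n : ℕ} (M : Matrix (Fin n) (Fin n) ℝ) (u v : Fin n → ℝ)
    (huv : u ⬝ᵥ u = v ⬝ᵥ v) : |u ⬝ᵥ M *ᵥ v| ≤ specNorm M * (v ⬝ᵥ v) := by
  have norm_sq (w : Fin n → ℝ) : ‖WithLp.toLp 2 w‖ ^ 2 = w ⬝ᵥ w := by
    rw [EuclideanSpace.real_norm_sq_eq]
    simp [dotProduct, sq]
  have hnorm : ‖WithLp.toLp 2 u‖ = ‖WithLp.toLp 2 v‖ := by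
    rw [← sq_eq_sq₀ (norm_nonneg _) (norm_nonneg _), norm_sq, norm_sq, huv]
  have hinner : u ⬝ᵥ M *ᵥ v = inner ℝ (WithLp.toLp 2 u)
      (LinearMap.toContinuousLinearMap (Matrix.toEuclideanLin M) (WithLp.toLp 2 v)) := by
    simp [PiLp.inner_apply, dotProduct, Matrix.toLpLin_apply, mul_comm]
  rw [hinner, ← norm_sq v]
  calc _ ≤ ‖WithLp.toLp 2 u‖ * ‖LinearMap.toContinuousLinearMap (Matrix.toEuclideanLin M)
        (WithLp.toLp 2 v)‖ := abs_real_inner_le_norm _ _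
    _ ≤ ‖WithLp.toLp 2 v‖ * (specNorm M * ‖WithLp.toLp 2 v‖) := by
        rw [hnorm]
        exact mul_le_mul_of_nonneg_left (ContinuousLinearMap.le_opNorm _ _) (norm_nonneg _)
    _ = _ := by ring

theorem specNorm_neg {n : ℕ} (M : Matrix (Fin n) (Fin n) ℝ) : specNorm (-M) = specNorm M := by
  simp [specNorm]

theorem specNorm_nonneg {n : ℕ} (M : Matrix (Fin n) (Fin n) ℝ) : 0 ≤ specNorm M :=
  norm_nonneg _

/-- The spectral norm of a symmetric matrix is bounded by any bound on its eigenvalues. -/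
theorem specNorm_le_of_eigenvalues {n : ℕ} {M : Matrix (Fin n) (Fin n) ℝ} (hM : M.IsSymm)
    {c : ℝ} (hc : 0 ≤ c)
    (h : ∀ (σ : ℝ) (x : Fin n → ℝ), x ≠ 0 → M *ᵥ x = σ • x → |σ| ≤ c) : specNorm M ≤ c := by
  have hH : M.IsHermitian := by
    rw [Matrix.IsHermitian, Matrix.conjTranspose_eq_transpose_of_trivial]
    exact hM
  have hev (i : Fin n) : |hH.eigenvalues i| ≤ c := by
    refine h _ _ ?_ (hH.mulVec_eigenvectorBasis i)
    intro h0
    exact hH.eigenvectorBasis.orthonormal.ne_zero i ((WithLp.ofLp_eq_zero 2).mp h0)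
  refine ContinuousLinearMap.opNorm_le_bound _ hc fun x => ?_
  rw [← sq_le_sq₀ (norm_nonneg _) (by positivity), mul_pow,
    ← hH.eigenvectorBasis.sum_sq_norm_inner_right, ← hH.eigenvectorBasis.sum_sq_norm_inner_right x,
    Finset.mul_sum]
  refine Finset.sum_le_sum fun i _ => ?_
  have hsymm := Matrix.isSymmetric_toEuclideanLin_iff.mpr hH
  have hb : Matrix.toEuclideanLin M (hH.eigenvectorBasis i)
      = hH.eigenvalues i • hH.eigenvectorBasis i := by
    apply (WithLp.ofLp_injective 2)
    simpa [Matrix.toLpLin_apply] using hH.mulVec_eigenvectorBasis i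
  have : inner ℝ (hH.eigenvectorBasis i) (Matrix.toEuclideanLin M x)
      = hH.eigenvalues i * inner ℝ (hH.eigenvectorBasis i) x := by
    rw [← hsymm, hb, real_inner_smul_left]
  rw [LinearMap.coe_toContinuousLinearMap', this, norm_mul, mul_pow]
  gcongr
  exact hev i

theorem dotProduct_conj_diagonal {n : ℕ} (V : Matrix (Fin n) (Fin n) ℝ) (e : Fin n → ℝ)
    (x : Fin n → ℝ) :
    x ⬝ᵥ (V * Matrix.diagonal e * Vᵀ) *ᵥ x = ∑ i, e i * (Vᵀ *ᵥ x) i ^ 2 := by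
  rw [← Matrix.mulVec_mulVec, ← Matrix.mulVec_mulVec, Matrix.dotProduct_mulVec,
    ← Matrix.mulVec_transpose, dotProduct]
  refine Finset.sum_congr rfl fun i _ => ?_
  rw [Matrix.mulVec_diagonal]
  ring

theorem dotProduct_self_eq_sum_sq {n : ℕ} {V : Matrix (Fin n) (Fin n) ℝ} (hV : Vᵀ * V = 1)
    (x : Fin n → ℝ) : x ⬝ᵥ x = ∑ i, (Vᵀ *ᵥ x) i ^ 2 := by
  have h := dotProduct_conj_diagonal V 1 x
  simpa [mul_eq_one_comm.mp hV] using h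

theorem conj_diagonal_le {n : ℕ} {V : Matrix (Fin n) (Fin n) ℝ} (hV : Vᵀ * V = 1)
    {e : Fin n → ℝ} {β : ℝ} {x : Fin n → ℝ} (h : ∀ i, (Vᵀ *ᵥ x) i = 0 ∨ e i ≤ β) :
    x ⬝ᵥ (V * Matrix.diagonal e * Vᵀ) *ᵥ x ≤ β * (x ⬝ᵥ x) := by
  rw [dotProduct_conj_diagonal, dotProduct_self_eq_sum_sq hV x, Finset.mul_sum]
  refine Finset.sum_le_sum fun i _ => ?_
  rcases h i with h | h
  · simp [h]
  · gcongr

theorem le_conj_diagonal {n : ℕ} {V : Matrix (Fin n) (Fin n) ℝ} (hV : Vᵀ * V = 1)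
    {e : Fin n → ℝ} {α : ℝ} {x : Fin n → ℝ} (h : ∀ i, (Vᵀ *ᵥ x) i = 0 ∨ α ≤ e i) :
    α * (x ⬝ᵥ x) ≤ x ⬝ᵥ (V * Matrix.diagonal e * Vᵀ) *ᵥ x := by
  rw [dotProduct_conj_diagonal, dotProduct_self_eq_sum_sq hV x, Finset.mul_sum]
  refine Finset.sum_le_sum fun i _ => ?_
  rcases h i with h | h
  · simp [h]
  · gcongr

/-- Weyl's inequality for ordered eigenvalues. -/
theorem weyl_le {n : ℕ} {A B V W : Matrix (Fin n) (Fin n) ℝ} {e f : Fin n → ℝ}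
    (hV : Vᵀ * V = 1) (he : ∀ i j : Fin n, i ≤ j → e j ≤ e i)
    (hA : A = V * Matrix.diagonal e * Vᵀ)
    (hW : Wᵀ * W = 1) (hf : ∀ i j : Fin n, i ≤ j → f j ≤ f i)
    (hB : B = W * Matrix.diagonal f * Wᵀ) (j : Fin n) :
    f j ≤ e j + specNorm (B - A) := by
  let T : (Fin n → ℝ) →ₗ[ℝ] ({i : Fin n // i < j} → ℝ) × ({i : Fin n // j < i} → ℝ) :=
    ((LinearMap.funLeft ℝ ℝ Subtype.val).comp (Matrix.mulVecLin Vᵀ)).prod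
      ((LinearMap.funLeft ℝ ℝ Subtype.val).comp (Matrix.mulVecLin Wᵀ))
  have hT : ¬ Function.Injective T := by
    intro h
    have := LinearMap.finrank_le_finrank_of_injective h
    have hlt : Fintype.card {i : Fin n // i < j} = j := by
      rw [Fintype.card_of_subtype (Finset.Iio j) (fun _ => Finset.mem_Iio), Fin.card_Iio]
    have hgt : Fintype.card {i : Fin n // j < i} = n - 1 - j := by
      rw [Fintype.card_of_subtype (Finset.Ioi j) (fun _ => Finset.mem_Ioi), Fin.card_Ioi]
    rw [Module.finrank_prod, Module.finrank_fintype_fun_eq_card,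
      Module.finrank_fintype_fun_eq_card, Module.finrank_fintype_fun_eq_card, hlt, hgt,
      Fintype.card_fin] at this
    omega
  obtain ⟨x, hx, hx0⟩ : ∃ x, T x = 0 ∧ x ≠ 0 := by
    by_contra! h
    exact hT ((injective_iff_map_eq_zero T).mpr h)
  have hx1 (i : Fin n) (hi : i < j) : (Vᵀ *ᵥ x) i = 0 := congrFun (congrArg Prod.fst hx) ⟨i, hi⟩
  have hx2 (i : Fin n) (hi : j < i) : (Wᵀ *ᵥ x) i = 0 := congrFun (congrArg Prod.snd hx) ⟨i, hi⟩
  have h1 : x ⬝ᵥ A *ᵥ x ≤ e j * (x ⬝ᵥ x) := by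
    rw [hA]
    exact conj_diagonal_le hV fun i => (lt_or_ge i j).imp (hx1 i) (he j i)
  have h2 : f j * (x ⬝ᵥ x) ≤ x ⬝ᵥ B *ᵥ x := by
    rw [hB]
    exact le_conj_diagonal hW fun i => (lt_or_ge j i).imp (hx2 i) (hf i j)
  have h3 := (abs_le.mp (dotProduct_mulVec_le_specNorm (B - A) x x rfl)).2
  rw [Matrix.sub_mulVec, dotProduct_sub] at h3
  have hpos : 0 < x ⬝ᵥ x := by
    have := dotProduct_star_self_pos_iff.mpr hx0
    simpa using this
  refine le_of_mul_le_mul_right ?_ hpos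
  linarith

/-- A positive eigenvalue `σ` of a difference `P - Q` of spectral projections of `A` and `B` is
controlled by the separation of `A` on the range of `P` from `B` on the kernel of `Q`. -/
theorem eigenvalue_mul_gap_le {n : ℕ} {A B P Q : Matrix (Fin n) (Fin n) ℝ}
    (hP : P.IsSymm) (hPP : P * P = P) (hQ : Q.IsSymm) (hQQ : Q * Q = Q)
    (hPA : P * A = A * P) (hQB : Q * B = B * Q) {α β : ℝ}
    (hα : ∀ v, P *ᵥ v = v → α * (v ⬝ᵥ v) ≤ v ⬝ᵥ A *ᵥ v)
    (hβ : ∀ u, Q *ᵥ u = 0 → u ⬝ᵥ B *ᵥ u ≤ β * (u ⬝ᵥ u))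
    {σ : ℝ} (hσ : 0 < σ) {x : Fin n → ℝ} (hx : x ≠ 0) (hJ : (P - Q) *ᵥ x = σ • x) :
    σ * (α - β) ≤ specNorm (B - A) := by
  have symm_dot {M : Matrix (Fin n) (Fin n) ℝ} (hM : M.IsSymm) (a b : Fin n → ℝ) :
      a ⬝ᵥ M *ᵥ b = (M *ᵥ a) ⬝ᵥ b := by
    rw [Matrix.dotProduct_mulVec, ← Matrix.mulVec_transpose, hM.eq]
  set v := P *ᵥ x with hv
  set u := x - Q *ᵥ x with hu
  have hJ' : v - Q *ᵥ x = σ • x := by rw [← hJ, Matrix.sub_mulVec]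
  have hPv : P *ᵥ v = v := by rw [hv, Matrix.mulVec_mulVec, hPP]
  have hQu : Q *ᵥ u = 0 := by
    rw [hu, Matrix.mulVec_sub, Matrix.mulVec_mulVec, hQQ, sub_self]
  have hPu : P *ᵥ u = σ • v := by
    have := congrArg (P *ᵥ ·) hJ'
    simp only [Matrix.mulVec_sub, Matrix.mulVec_smul, hPv] at this
    rw [hu, Matrix.mulVec_sub, ← hv, this]
  have hQv : v - Q *ᵥ v = σ • u := by
    have := congrArg (Q *ᵥ ·) hJ'
    simp only [Matrix.mulVec_sub, Matrix.mulVec_smul, Matrix.mulVec_mulVec, hQQ] at this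
    rw [hu, smul_sub, ← hJ', ← this]
    abel
  have huv : u ⬝ᵥ v = σ * (v ⬝ᵥ v) := by
    rw [← hPv, symm_dot hP, hPu, hPv, smul_dotProduct, smul_eq_mul]
  have huv' : u ⬝ᵥ v = σ * (u ⬝ᵥ u) := by
    have : v = σ • u + Q *ᵥ v := by rw [← hQv]; abel
    rw [this, dotProduct_add, symm_dot hQ, hQu, zero_dotProduct, dotProduct_smul, add_zero,
      smul_eq_mul]
  have hnorm : u ⬝ᵥ u = v ⬝ᵥ v := mul_left_cancel₀ hσ.ne' (huv'.symm.trans huv)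
  have hpos : 0 < v ⬝ᵥ v := by
    have hv0 : v ≠ 0 := by
      intro h0
      have hu0 : u = 0 := by
        rw [h0, dotProduct_zero] at hnorm
        exact dotProduct_self_eq_zero.mp hnorm
      have hQx : Q *ᵥ x = x := (sub_eq_zero.mp (hu ▸ hu0)).symm
      rw [h0, hQx, zero_sub] at hJ'
      have : (σ + 1) • x = 0 := by rw [add_smul, ← hJ', one_smul]; abel
      rcases smul_eq_zero.mp this with h | h
      · linarith
      · exact hx h
    simpa using dotProduct_star_self_pos_iff.mpr hv0
  have hA : u ⬝ᵥ A *ᵥ v = σ * (v ⬝ᵥ A *ᵥ v) := by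
    have : A *ᵥ v = P *ᵥ (A *ᵥ v) := by
      rw [Matrix.mulVec_mulVec v P A, hPA, ← Matrix.mulVec_mulVec, hPv]
    rw [this, symm_dot hP, hPu, ← this, smul_dotProduct, smul_eq_mul]
  have hB : u ⬝ᵥ B *ᵥ v = σ * (u ⬝ᵥ B *ᵥ u) := by
    have : v = σ • u + Q *ᵥ v := by rw [← hQv]; abel
    rw [this, Matrix.mulVec_add, Matrix.mulVec_mulVec _ B Q, ← hQB, ← Matrix.mulVec_mulVec,
      dotProduct_add, symm_dot hQ, hQu, zero_dotProduct, Matrix.mulVec_smul, dotProduct_smul,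
      add_zero, smul_eq_mul]
  have hZ := (abs_le.mp (dotProduct_mulVec_le_specNorm (B - A) u v hnorm)).1
  rw [Matrix.sub_mulVec, dotProduct_sub, hA, hB] at hZ
  have h1 := mul_le_mul_of_nonneg_left (hα v hPv) hσ.le
  have h2 := mul_le_mul_of_nonneg_left (hβ u hQu) hσ.le
  rw [hnorm] at h2
  refine le_of_mul_le_mul_right ?_ hpos
  linarith

theorem conj_diagonal_mul {n : ℕ} {V : Matrix (Fin n) (Fin n) ℝ} (hV : Vᵀ * V = 1)
    (d e : Fin n → ℝ) :
    (V * Matrix.diagonal d * Vᵀ) * (V * Matrix.diagonal e * Vᵀ)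
      = V * Matrix.diagonal (d * e) * Vᵀ := by
  calc _ = V * Matrix.diagonal d * (Vᵀ * V) * Matrix.diagonal e * Vᵀ := by
        simp only [Matrix.mul_assoc]
    _ = _ := by
        rw [hV, Matrix.mul_one, Matrix.mul_assoc V, Matrix.diagonal_mul_diagonal]
        rfl

theorem conj_diagonal_isSymm {n : ℕ} (V : Matrix (Fin n) (Fin n) ℝ) (d : Fin n → ℝ) :
    (V * Matrix.diagonal d * Vᵀ).IsSymm := by
  simp [Matrix.IsSymm, Matrix.transpose_mul, Matrix.mul_assoc]

theorem transpose_mulVec_conj_diagonal {n : ℕ} {V : Matrix (Fin n) (Fin n) ℝ} (hV : Vᵀ * V = 1)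
    (d x : Fin n → ℝ) (i : Fin n) :
    (Vᵀ *ᵥ ((V * Matrix.diagonal d * Vᵀ) *ᵥ x)) i = d i * (Vᵀ *ᵥ x) i := by
  rw [Matrix.mulVec_mulVec, ← Matrix.mul_assoc, ← Matrix.mul_assoc, hV, Matrix.one_mul,
    ← Matrix.mulVec_mulVec, Matrix.mulVec_diagonal]

/-- The indicator of the first `k` indices. -/
def leadingIndicator (n k : ℕ) (i : Fin n) : ℝ := if (i : ℕ) < k then 1 else 0

theorem leadingIndicator_mul_self (n k : ℕ) :
    leadingIndicator n k * leadingIndicator n k = leadingIndicator n k := by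
  ext i
  simp [leadingIndicator]

theorem leadingColumns_mul_transpose {n k : ℕ} (hkn : k ≤ n) (V : Matrix (Fin n) (Fin n) ℝ) :
    (Matrix.of fun i j => V i (Fin.castLE hkn j) : Matrix (Fin n) (Fin k) ℝ) *
      (Matrix.of fun i j => V i (Fin.castLE hkn j) : Matrix (Fin n) (Fin k) ℝ)ᵀ
      = V * Matrix.diagonal (leadingIndicator n k) * Vᵀ := by
  ext a b
  rw [Matrix.mul_apply, Matrix.mul_apply]
  simp only [Matrix.mul_diagonal, Matrix.transpose_apply, Matrix.of_apply,
    leadingIndicator, mul_ite, mul_one, mul_zero, ite_mul, zero_mul]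
  rw [← Finset.sum_filter]
  refine Finset.sum_bij (fun j _ => Fin.castLE hkn j) ?_ ?_ ?_ ?_
  · simp
  · intro i _ j _ h
    exact Fin.castLE_injective hkn h
  · intro i hi
    exact ⟨⟨i, (Finset.mem_filter.mp hi).2⟩, Finset.mem_univ _, rfl⟩
  · simp

/-- The `sin Θ` bound for the leading spectral projections of two symmetric matrices. -/
theorem leading_eigenvalue_mul_gap_le {n k : ℕ} {A B V W : Matrix (Fin n) (Fin n) ℝ}
    {e f : Fin n → ℝ} (hV : Vᵀ * V = 1) (hA : A = V * Matrix.diagonal e * Vᵀ)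
    (hW : Wᵀ * W = 1) (hB : B = W * Matrix.diagonal f * Wᵀ) {α β : ℝ}
    (hα : ∀ i : Fin n, (i : ℕ) < k → α ≤ e i) (hβ : ∀ i : Fin n, k ≤ (i : ℕ) → f i ≤ β)
    {σ : ℝ} (hσ : 0 < σ) {x : Fin n → ℝ} (hx : x ≠ 0)
    (hJ : (V * Matrix.diagonal (leadingIndicator n k) * Vᵀ
      - W * Matrix.diagonal (leadingIndicator n k) * Wᵀ) *ᵥ x = σ • x) :
    σ * (α - β) ≤ specNorm (B - A) := by
  refine eigenvalue_mul_gap_le (conj_diagonal_isSymm _ _) ?_ (conj_diagonal_isSymm _ _) ?_ ?_ ?_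
    ?_ ?_ hσ hx hJ
  · rw [conj_diagonal_mul hV, leadingIndicator_mul_self]
  · rw [conj_diagonal_mul hW, leadingIndicator_mul_self]
  · rw [hA, conj_diagonal_mul hV, conj_diagonal_mul hV, mul_comm]
  · rw [hB, conj_diagonal_mul hW, conj_diagonal_mul hW, mul_comm]
  · intro v hv
    rw [hA]
    refine le_conj_diagonal hV fun i => ?_
    rcases lt_or_ge (i : ℕ) k with hi | hi
    · exact Or.inr (hα i hi)
    · left
      rw [← hv, transpose_mulVec_conj_diagonal hV]
      simp [leadingIndicator, hi.not_gt]
  · intro u hu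
    rw [hB]
    refine conj_diagonal_le hW fun i => ?_
    rcases lt_or_ge (i : ℕ) k with hi | hi
    · left
      have := transpose_mulVec_conj_diagonal hW (leadingIndicator n k) u i
      rw [hu] at this
      simpa [leadingIndicator, hi] using this.symm
    · exact Or.inr (hβ i hi)

/-- Davis–Kahan: if `Ã = A + Z` with `A, Z` symmetric, the eigengap
`Δ_k = λ_k(A) − λ_{k+1}(A)` is positive and `‖Z‖₂ ≤ (1 − 1/√2) Δ_k`, then the top-k
eigenspaces of `A` and `Ã` satisfy `dist(U, Ũ) ≤ 2 ‖Z‖₂ / Δ_k`. -/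
theorem davis_kahan {n k : ℕ} (hk : 0 < k) (hkn : k < n)
    (A Z : Matrix (Fin n) (Fin n) ℝ) (hAsymm : A.IsSymm) (hZsymm : Z.IsSymm)
    (V W : Matrix (Fin n) (Fin n) ℝ) (eigs eigs' : Fin n → ℝ)
    (hV : Vᵀ * V = 1) (hdec : ∀ i j : Fin n, i ≤ j → eigs j ≤ eigs i)
    (hAdec : A = V * Matrix.diagonal eigs * Vᵀ)
    (hW : Wᵀ * W = 1) (hdec' : ∀ i j : Fin n, i ≤ j → eigs' j ≤ eigs' i)
    (hAZdec : A + Z = W * Matrix.diagonal eigs' * Wᵀ)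
    (U Ut : Matrix (Fin n) (Fin k) ℝ)
    (hU : U = Matrix.of fun i j => V i (Fin.castLE (le_of_lt hkn) j))
    (hUt : Ut = Matrix.of fun i j => W i (Fin.castLE (le_of_lt hkn) j))
    (Δk : ℝ) (hΔk : Δk = eigs ⟨k - 1, by omega⟩ - eigs ⟨k, hkn⟩) (hΔpos : 0 < Δk)
    (hZnorm : specNorm Z ≤ (1 - 1 / Real.sqrt 2) * Δk) :
    projDist U Ut ≤ 2 * specNorm Z / Δk := by
  have hz := specNorm_nonneg Z
  have hBA : A + Z - A = Z := add_sub_cancel_left A Z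
  have hAB : A - (A + Z) = -Z := by abel
  have hweyl := weyl_le hV hdec hAdec hW hdec' hAZdec ⟨k, hkn⟩
  have hweyl' := weyl_le hW hdec' hAZdec hV hdec hAdec ⟨k - 1, by omega⟩
  rw [hBA] at hweyl
  rw [hAB, specNorm_neg] at hweyl'
  have hhalf : specNorm Z ≤ Δk / 2 := by
    have hs : Real.sqrt 2 ≤ 2 := Real.sqrt_le_iff.mpr (by norm_num)
    have hs' : 1 / 2 ≤ 1 / Real.sqrt 2 := one_div_le_one_div_of_le (by positivity) hs
    nlinarith
  have finish {σ g : ℝ} (hσ : 0 < σ) (hg : Δk - specNorm Z ≤ g) (h : σ * g ≤ specNorm Z) :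
      σ ≤ 2 * specNorm Z / Δk := by
    rw [le_div_iff₀ hΔpos]
    nlinarith
  rw [projDist, hU, hUt, leadingColumns_mul_transpose, leadingColumns_mul_transpose]
  refine specNorm_le_of_eigenvalues
    ((conj_diagonal_isSymm _ _).sub (conj_diagonal_isSymm _ _)) (by positivity) ?_
  intro σ x hx hJ
  rcases lt_trichotomy σ 0 with hσ | rfl | hσ
  · rw [abs_of_neg hσ]
    have hJ' := congrArg Neg.neg hJ
    rw [← Matrix.neg_mulVec, neg_sub, ← neg_smul] at hJ'
    have h := leading_eigenvalue_mul_gap_le hW hAZdec hV hAdec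
      (α := eigs' ⟨k - 1, by omega⟩) (β := eigs ⟨k, hkn⟩)
      (fun i hi => hdec' _ _ (Fin.mk_le_mk.mpr (by omega)))
      (fun i hi => hdec _ _ (Fin.mk_le_mk.mpr hi)) (neg_pos.mpr hσ) hx hJ'
    rw [hAB, specNorm_neg] at h
    exact finish (neg_pos.mpr hσ) (by linarith) h
  · rw [abs_zero]
    positivity
  · rw [abs_of_pos hσ]
    have h := leading_eigenvalue_mul_gap_le hV hAdec hW hAZdec
      (α := eigs ⟨k - 1, by omega⟩) (β := eigs' ⟨k, hkn⟩)
      (fun i hi => hdec _ _ (Fin.mk_le_mk.mpr (by omega)))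
      (fun i hi => hdec' _ _ (Fin.mk_le_mk.mpr hi)) hσ hx hJ
    rw [hBA] at h
    exact finish hσ (by linarith) h

end
end

section
/- Let U, Ũ ∈ ℝ^{n×k} be column-orthonormal matrices. Then there exists an orthogonal matrix R ∈ O(k) such that (1/√n)·‖Ũ − U·R‖_F ≤ √(2k) · dist(U, Ũ). -/
open MeasureTheory ProbabilityTheory Matrix
open scoped ENNReal NNReal

set_option autoImplicit false

noncomputable section

/-- A contraction of a finite-dimensional Euclidean space carries some orthonormal basis `b` to
vectors `f (b i)` that are aligned with another orthonormal basis `c`. -/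
theorem exists_orthonormalBasis_sq_norm_le_inner {ι E : Type*} [Fintype ι]
    [NormedAddCommGroup E] [InnerProductSpace ℝ E] [FiniteDimensional ℝ E]
    (e : OrthonormalBasis ι ℝ E) (f : E →ₗ[ℝ] E) (hf : ∀ x, ‖f x‖ ≤ ‖x‖) :
    ∃ b c : OrthonormalBasis ι ℝ E, ∀ i, ‖f (b i)‖ ^ 2 ≤ inner ℝ (c i) (f (b i)) := by
  have hcard : Module.finrank ℝ E = Fintype.card ι := Module.finrank_eq_card_basis e.toBasis
  have hsymm := f.isSymmetric_adjoint_comp_self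
  let b : OrthonormalBasis ι ℝ E :=
    (hsymm.eigenvectorBasis hcard).reindex (Fintype.equivFin ι).symm
  have horth : ∀ i j, i ≠ j → inner ℝ (f (b i)) (f (b j)) = 0 := by
    intro i j hij
    rw [← LinearMap.adjoint_inner_right, ← LinearMap.comp_apply]
    simp only [b, OrthonormalBasis.reindex_apply, Equiv.symm_symm,
      hsymm.apply_eigenvectorBasis, inner_smul_right]
    rw [(hsymm.eigenvectorBasis hcard).orthonormal.2 (by simpa using hij), mul_zero]
  have hw : Orthonormal ℝ (Set.domRestrict {i | f (b i) ≠ 0} fun i => ‖f (b i)‖⁻¹ • f (b i)) := by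
    refine ⟨fun i => ?_, fun i j hij => ?_⟩
    · have : ‖f (b i)‖ ≠ 0 := norm_ne_zero_iff.2 i.2
      simp [norm_smul, this]
    · simp [inner_smul_left, inner_smul_right,
        horth i j (fun h => hij (Subtype.ext h))]
  obtain ⟨c, hc⟩ := hw.exists_orthonormalBasis_extension_of_card_eq hcard
  refine ⟨b, c, fun i => ?_⟩
  by_cases hi : f (b i) = 0
  · simp [hi]
  · have hpos : 0 < ‖f (b i)‖ := norm_pos_iff.2 hi
    have hle : ‖f (b i)‖ ≤ 1 := by simpa using hf (b i)
    rw [hc i hi, real_inner_smul_left, real_inner_self_eq_norm_sq, pow_two,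
      inv_mul_cancel_left₀ hpos.ne']
    nlinarith

/-- A contractive matrix `M` admits an orthogonal matrix `R` with `tr (Mᵀ M) ≤ tr (Rᵀ M)`. -/
theorem exists_orthogonal_trace_le {k : ℕ} (M : Matrix (Fin k) (Fin k) ℝ)
    (hM : ∀ x, ‖M.toEuclideanLin x‖ ≤ ‖x‖) :
    ∃ R : Matrix (Fin k) (Fin k) ℝ, Rᵀ * R = 1 ∧ (Mᵀ * M).trace ≤ (Rᵀ * M).trace := by
  obtain ⟨b, c, h⟩ := exists_orthonormalBasis_sq_norm_le_inner
    (EuclideanSpace.basisFun (Fin k) ℝ) M.toEuclideanLin hM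
  let B : Matrix (Fin k) (Fin k) ℝ := Matrix.of fun i j => b j i
  let C : Matrix (Fin k) (Fin k) ℝ := Matrix.of fun i j => c j i
  have key : ∀ d : OrthonormalBasis (Fin k) ℝ (EuclideanSpace ℝ (Fin k)),
      (Matrix.of fun i j => d j i)ᵀ * (Matrix.of fun i j => d j i) = 1 := by
    intro d
    ext i j
    have := orthonormal_iff_ite.1 d.orthonormal j i
    simp only [PiLp.inner_apply, RCLike.inner_apply, conj_trivial] at this
    simp [Matrix.mul_apply, Matrix.one_apply, this, eq_comm]
  have hB : Bᵀ * B = 1 := key b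
  have hC : Cᵀ * C = 1 := key c
  have hB' : B * Bᵀ = 1 := mul_eq_one_comm.1 hB
  refine ⟨C * Bᵀ, ?_, ?_⟩
  · calc (C * Bᵀ)ᵀ * (C * Bᵀ) = B * (Cᵀ * C) * Bᵀ := by
          simp only [Matrix.transpose_mul, Matrix.transpose_transpose, Matrix.mul_assoc]
      _ = 1 := by rw [hC, Matrix.mul_one, hB']
  · have h1 : (Mᵀ * M).trace = ((M * B)ᵀ * (M * B)).trace := by
      rw [Matrix.transpose_mul, Matrix.mul_assoc, Matrix.trace_mul_comm Bᵀ, ← Matrix.mul_assoc Mᵀ,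
        Matrix.mul_assoc, hB', Matrix.mul_one]
    have h2 : ((C * Bᵀ)ᵀ * M).trace = (Cᵀ * (M * B)).trace := by
      rw [Matrix.transpose_mul, Matrix.transpose_transpose, Matrix.mul_assoc,
        Matrix.trace_mul_comm, Matrix.mul_assoc]
    rw [h1, h2]
    refine Finset.sum_le_sum fun i _ => ?_
    have hMB : ∀ l, (M * B) l i = M.toEuclideanLin (b i) l := fun l => by
      simp [B, Matrix.mul_apply, Matrix.mulVec, dotProduct]
    have := h i
    rw [EuclideanSpace.real_norm_sq_eq] at this
    simp only [PiLp.inner_apply, RCLike.inner_apply, conj_trivial] at this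
    simp only [Matrix.diag_apply, Matrix.mul_apply (M := Cᵀ), Matrix.mul_apply (M := (M * B)ᵀ),
      Matrix.transpose_apply, hMB]
    simpa [C, pow_two, mul_comm] using this

theorem frobNorm_sq {n k : ℕ} (A : Matrix (Fin n) (Fin k) ℝ) :
    frobNorm A ^ 2 = (Aᵀ * A).trace := by
  have h : 0 ≤ ∑ i, ∑ j, A i j ^ 2 := by positivity
  rw [frobNorm, Real.sq_sqrt h, Finset.sum_comm]
  simp [Matrix.trace, Matrix.mul_apply, pow_two]

theorem sq_norm_toEuclideanLin {n k : ℕ} (A : Matrix (Fin n) (Fin k) ℝ)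
    (x : EuclideanSpace ℝ (Fin k)) :
    ‖A.toEuclideanLin x‖ ^ 2 = x.ofLp ⬝ᵥ ((Aᵀ * A) *ᵥ x.ofLp) := by
  rw [EuclideanSpace.real_norm_sq_eq, ← Matrix.mulVec_mulVec, Matrix.dotProduct_mulVec,
    Matrix.vecMul_transpose]
  simp [dotProduct, pow_two]

/-- Multiplying by a matrix with `k` orthonormal columns bounds the Frobenius norm by the
spectral norm. -/
theorem frobNorm_mul_sq_le {n m k : ℕ} (D : Matrix (Fin m) (Fin n) ℝ)
    (V : Matrix (Fin n) (Fin k) ℝ) (hV : Vᵀ * V = 1) :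
    frobNorm (D * V) ^ 2 ≤ k * specNorm D ^ 2 := by
  have hcol : ∀ j, ‖D.toEuclideanLin (WithLp.toLp 2 (V.col j))‖ ^ 2 ≤ specNorm D ^ 2 := by
    intro j
    have hnorm : ‖WithLp.toLp 2 (V.col j)‖ = 1 := by
      have h : ‖WithLp.toLp 2 (V.col j)‖ ^ 2 = 1 := by
        have := congrFun₂ hV j j
        rw [EuclideanSpace.real_norm_sq_eq]
        simpa [Matrix.mul_apply, pow_two] using this
      exact (pow_eq_one_iff_of_nonneg (norm_nonneg _) two_ne_zero).1 h
    have := (LinearMap.toContinuousLinearMap D.toEuclideanLin).le_opNorm (WithLp.toLp 2 (V.col j))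
    rw [hnorm, mul_one] at this
    exact pow_le_pow_left₀ (norm_nonneg _) this 2
  calc frobNorm (D * V) ^ 2
      = ∑ j, ‖D.toEuclideanLin (WithLp.toLp 2 (V.col j))‖ ^ 2 := by
        simp only [frobNorm_sq, EuclideanSpace.real_norm_sq_eq]
        simp [Matrix.trace, pow_two, Matrix.mul_apply, Matrix.mulVec, dotProduct,
          -Matrix.transpose_mul]
    _ ≤ ∑ _j : Fin k, specNorm D ^ 2 := Finset.sum_le_sum fun j _ => hcol j
    _ = k * specNorm D ^ 2 := by simp

/-- Procrustes alignment: for column-orthonormal `U, Ũ ∈ ℝ^{n×k}`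
there is an orthogonal `R ∈ O(k)` with `(1/√n)·‖Ũ − U R‖_F ≤ √(2k)·dist(U, Ũ)`. -/
theorem procrustes_alignment {n k : ℕ} (U Ut : Matrix (Fin n) (Fin k) ℝ)
    (hU : Uᵀ * U = 1) (hUt : Utᵀ * Ut = 1) :
    ∃ R : Matrix (Fin k) (Fin k) ℝ, Rᵀ * R = 1 ∧
      (1 / Real.sqrt n) * frobNorm (Ut - U * R) ≤
        Real.sqrt (2 * k) * projDist U Ut := by
  have gram : ∀ R : Matrix (Fin k) (Fin k) ℝ, (Ut - U * R)ᵀ * (Ut - U * R) =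
      1 - (Uᵀ * Ut)ᵀ * R - Rᵀ * (Uᵀ * Ut) + Rᵀ * R := by
    intro R
    have h : Rᵀ * Uᵀ * (U * R) = Rᵀ * R := by
      rw [Matrix.mul_assoc, ← Matrix.mul_assoc Uᵀ, hU, Matrix.one_mul]
    rw [Matrix.transpose_sub, Matrix.sub_mul, Matrix.mul_sub, Matrix.mul_sub, hUt,
      Matrix.transpose_mul, Matrix.transpose_mul, Matrix.transpose_transpose, h,
      Matrix.mul_assoc, Matrix.mul_assoc]
    abel
  set M := Uᵀ * Ut with hMdef
  have gramM : (Ut - U * M)ᵀ * (Ut - U * M) = 1 - Mᵀ * M := by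
    rw [gram]; abel
  have hcontr : ∀ x, ‖M.toEuclideanLin x‖ ≤ ‖x‖ := by
    intro x
    have h1 := sq_norm_toEuclideanLin (Ut - U * M) x
    rw [gramM, Matrix.sub_mulVec, dotProduct_sub, ← sq_norm_toEuclideanLin, Matrix.one_mulVec] at h1
    have h2 : x.ofLp ⬝ᵥ x.ofLp = ‖x‖ ^ 2 := by
      rw [EuclideanSpace.real_norm_sq_eq]
      simp [dotProduct, pow_two]
    rw [h2] at h1
    exact le_of_sq_le_sq (by nlinarith [sq_nonneg ‖(Ut - U * M).toEuclideanLin x‖]) (norm_nonneg _)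
  obtain ⟨R, hR, htr⟩ := exists_orthogonal_trace_le M hcontr
  refine ⟨R, hR, ?_⟩
  have hD : (U * Uᵀ - Ut * Utᵀ) * Ut = -(Ut - U * M) := by
    rw [Matrix.sub_mul, Matrix.mul_assoc, Matrix.mul_assoc, hUt, Matrix.mul_one, neg_sub]
  have hbound := frobNorm_mul_sq_le (U * Uᵀ - Ut * Utᵀ) Ut hUt
  rw [hD, frobNorm_sq, Matrix.transpose_neg, Matrix.neg_mul, Matrix.mul_neg,
    neg_neg, gramM, Matrix.trace_sub] at hbound
  have hfrob : frobNorm (Ut - U * R) ^ 2 ≤ 2 * k * projDist U Ut ^ 2 := by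
    have hcomm : (Mᵀ * R).trace = (Rᵀ * M).trace := by
      rw [← Matrix.trace_transpose, Matrix.transpose_mul, Matrix.transpose_transpose]
    rw [frobNorm_sq, gram, hR, Matrix.trace_add, Matrix.trace_sub, Matrix.trace_sub, hcomm, projDist]
    linarith
  have hd : 0 ≤ projDist U Ut := norm_nonneg _
  have hinv : 1 / Real.sqrt n ≤ 1 := by
    rcases Nat.eq_zero_or_pos n with rfl | hn
    · simp
    · exact (div_le_one (by positivity)).2 (Real.one_le_sqrt.2 (by exact_mod_cast hn))
  calc 1 / Real.sqrt n * frobNorm (Ut - U * R) ≤ frobNorm (Ut - U * R) :=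
        mul_le_of_le_one_left (Real.sqrt_nonneg _) hinv
    _ ≤ Real.sqrt (2 * k * projDist U Ut ^ 2) := Real.le_sqrt_of_sq_le hfrob
    _ = Real.sqrt (2 * k) * projDist U Ut := by
        rw [Real.sqrt_mul (by positivity), Real.sqrt_sq hd]

end
end

section
/- Let X, U ∈ ℝ^{n×k} have orthonormal columns and suppose ‖(I − X·Xᵀ)·U‖₂ ≤ τ. Then there exists an orthogonal matrix R ∈ O(k) such that ‖X − U·R‖_F ≤ √(2k)·τ. -/
open MeasureTheory ProbabilityTheory Matrix
open scoped ENNReal NNReal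

set_option autoImplicit false

noncomputable section

/-- A pairwise orthogonal family indexed by the dimension is a rescaled orthonormal basis. -/
theorem exists_orthonormalBasis_eq_norm_smul {ι E : Type*} [Fintype ι] [NormedAddCommGroup E]
    [InnerProductSpace ℝ E] [FiniteDimensional ℝ E]
    (hcard : Module.finrank ℝ E = Fintype.card ι) (c : ι → E)
    (hc : Pairwise fun i j => inner ℝ (c i) (c j) = 0) :
    ∃ b : OrthonormalBasis ι ℝ E, ∀ i, c i = ‖c i‖ • b i := by
  have hv : Orthonormal ℝ ({i | c i ≠ 0}.domRestrict fun i => ‖c i‖⁻¹ • c i) := by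
    refine ⟨fun i => ?_, fun i j hij => ?_⟩
    · have hi : ‖c i‖ ≠ 0 := norm_ne_zero_iff.mpr i.2
      simp [norm_smul, hi]
    · have hij' : (i : ι) ≠ j := fun h => hij (Subtype.ext h)
      simp [inner_smul_left, inner_smul_right, hc hij']
  obtain ⟨b, hb⟩ := hv.exists_orthonormalBasis_extension_of_card_eq hcard
  refine ⟨b, fun i => ?_⟩
  by_cases hi : c i = 0
  · simp [hi]
  · rw [hb i hi, smul_inv_smul₀ (norm_ne_zero_iff.mpr hi)]

/-- The matrix whose columns form an orthonormal basis is orthogonal. -/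
theorem OrthonormalBasis.transpose_mul_of_columns {ι : Type*} [Fintype ι] [DecidableEq ι]
    (b : OrthonormalBasis ι ℝ (EuclideanSpace ℝ ι)) :
    (Matrix.of fun i j => b j i)ᵀ * (Matrix.of fun i j => b j i) = 1 := by
  ext i j
  have h := orthonormal_iff_ite.mp b.orthonormal i j
  simp only [PiLp.inner_apply, RCLike.inner_apply, conj_trivial] at h
  simp only [Matrix.mul_apply, Matrix.transpose_apply, Matrix.of_apply, Matrix.one_apply, ← h]
  exact Finset.sum_congr rfl fun x _ => mul_comm _ _

/-- Singular value decomposition of a real square matrix. -/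
theorem Matrix.exists_svd {ι : Type*} [Fintype ι] [DecidableEq ι] (A : Matrix ι ι ℝ) :
    ∃ (V W : Matrix ι ι ℝ) (s : ι → ℝ), Vᵀ * V = 1 ∧ Wᵀ * W = 1 ∧ (∀ i, 0 ≤ s i) ∧
      A * V = W * Matrix.diagonal s := by
  have hA : (Aᵀ * A).IsHermitian := by
    simpa using Matrix.isHermitian_conjTranspose_mul_self A
  let v := hA.eigenvectorBasis
  let c : ι → EuclideanSpace ℝ ι := fun j => WithLp.toLp 2 (A *ᵥ ⇑(v j))
  have hc : Pairwise fun i j => inner ℝ (c i) (c j) = 0 := by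
    intro i j hij
    have h := orthonormal_iff_ite.mp v.orthonormal i j
    rw [if_neg hij, EuclideanSpace.inner_eq_star_dotProduct, star_trivial] at h
    rw [EuclideanSpace.inner_eq_star_dotProduct, star_trivial]
    change (A *ᵥ ⇑(v j)) ⬝ᵥ (A *ᵥ ⇑(v i)) = 0
    rw [dotProduct_comm, Matrix.dotProduct_mulVec, Matrix.vecMul_mulVec,
      ← Matrix.mulVec_transpose, Matrix.transpose_mul, Matrix.transpose_transpose,
      hA.mulVec_eigenvectorBasis, smul_dotProduct, dotProduct_comm]
    exact smul_eq_zero_of_right _ h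
  obtain ⟨w, hw⟩ := exists_orthonormalBasis_eq_norm_smul (by simp) c hc
  refine ⟨_, _, fun i => ‖c i‖, v.transpose_mul_of_columns, w.transpose_mul_of_columns,
    fun i => norm_nonneg _, ?_⟩
  ext i j
  have h := congrArg (fun x : EuclideanSpace ℝ ι => x i) (hw j)
  rw [Matrix.mul_diagonal, Matrix.of_apply, mul_comm]
  exact h

theorem Matrix.transpose_mul_self_apply_self {m ι : Type*} [Fintype m] (M : Matrix m ι ℝ) (i : ι) :
    (Mᵀ * M) i i = ∑ j, M j i ^ 2 := by
  simp [Matrix.mul_apply, sq]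

theorem frobNorm_eq_sqrt_trace {n m : ℕ} (M : Matrix (Fin n) (Fin m) ℝ) :
    frobNorm M = Real.sqrt (Mᵀ * M).trace := by
  rw [frobNorm, Finset.sum_comm]
  simp [Matrix.trace, Matrix.transpose_mul_self_apply_self]

theorem sum_sq_mulVec_le {n m : ℕ} (M : Matrix (Fin n) (Fin m) ℝ) (x : Fin m → ℝ) :
    ∑ j, (M *ᵥ x) j ^ 2 ≤ specNorm M ^ 2 * ∑ j, x j ^ 2 := by
  have h := (LinearMap.toContinuousLinearMap (Matrix.toEuclideanLin M)).le_opNorm (WithLp.toLp 2 x)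
  have h2 := pow_le_pow_left₀ (norm_nonneg _) h 2
  rw [mul_pow, EuclideanSpace.real_norm_sq_eq, EuclideanSpace.real_norm_sq_eq] at h2
  exact h2

/-- Projection bound to Procrustes bound: if `X, U ∈ ℝ^{n×k}` have
orthonormal columns and `‖(I − X Xᵀ) U‖₂ ≤ τ`, then there is an orthogonal `R ∈ O(k)`
with `‖X − U R‖_F ≤ √(2k) τ`. -/
theorem projection_to_procrustes {n k : ℕ} (X U : Matrix (Fin n) (Fin k) ℝ)
    (hX : Xᵀ * X = 1) (hU : Uᵀ * U = 1) (τ : ℝ)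
    (h : specNorm ((1 - X * Xᵀ) * U) ≤ τ) :
    ∃ R : Matrix (Fin k) (Fin k) ℝ, Rᵀ * R = 1 ∧
      frobNorm (X - U * R) ≤ Real.sqrt (2 * k) * τ := by
  have hτ : 0 ≤ specNorm ((1 - X * Xᵀ) * U) := norm_nonneg _
  obtain ⟨V, W, s, hV, hW, hs, hsvd⟩ := (Xᵀ * U).exists_svd
  have hV' : V * Vᵀ = 1 := mul_eq_one_comm.mp hV
  have hW' : W * Wᵀ = 1 := mul_eq_one_comm.mp hW
  let B : Matrix (Fin n) (Fin k) ℝ := (1 - X * Xᵀ) * U * V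
  have hBB : Bᵀ * B = 1 - Matrix.diagonal fun i => s i * s i := by
    have hP : (1 - X * Xᵀ)ᵀ * (1 - X * Xᵀ) = 1 - X * Xᵀ := by
      have : X * Xᵀ * (X * Xᵀ) = X * Xᵀ := by
        rw [Matrix.mul_assoc, ← Matrix.mul_assoc Xᵀ, hX, Matrix.one_mul]
      simp [Matrix.sub_mul, Matrix.mul_sub, this]
    calc Bᵀ * B = Vᵀ * (Uᵀ * ((1 - X * Xᵀ)ᵀ * (1 - X * Xᵀ)) * U) * V := by
          simp only [B, Matrix.transpose_mul, Matrix.mul_assoc]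
      _ = Vᵀ * (Uᵀ * U) * V - (Xᵀ * U * V)ᵀ * (Xᵀ * U * V) := by
          rw [hP]
          simp only [Matrix.transpose_mul, Matrix.transpose_transpose, Matrix.mul_sub,
            Matrix.sub_mul, Matrix.mul_one, Matrix.mul_assoc]
      _ = 1 - Matrix.diagonal s * (Wᵀ * W) * Matrix.diagonal s := by
          rw [hU, hsvd, Matrix.mul_one, hV, Matrix.transpose_mul, Matrix.diagonal_transpose]
          simp only [Matrix.mul_assoc]
      _ = _ := by rw [hW, Matrix.mul_one, Matrix.diagonal_mul_diagonal]
  have hcol (i : Fin k) : 0 ≤ 1 - s i * s i ∧ 1 - s i * s i ≤ τ ^ 2 := by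
    have hi : ∑ j, B j i ^ 2 = 1 - s i * s i := by
      rw [← Matrix.transpose_mul_self_apply_self, hBB]
      simp
    have hVi : ∑ j, V j i ^ 2 = 1 := by
      rw [← Matrix.transpose_mul_self_apply_self, hV, Matrix.one_apply_eq]
    refine ⟨hi ▸ Finset.sum_nonneg fun j _ => sq_nonneg _, ?_⟩
    have hle := sum_sq_mulVec_le ((1 - X * Xᵀ) * U) fun j => V j i
    rw [hVi, mul_one] at hle
    rw [← hi]
    exact hle.trans (pow_le_pow_left₀ hτ h 2)
  have hterm (i : Fin k) : 2 - 2 * s i ≤ 2 * τ ^ 2 := by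
    nlinarith [hcol i, hs i]
  refine ⟨V * Wᵀ, ?_, ?_⟩
  · rw [Matrix.transpose_mul, Matrix.transpose_transpose, Matrix.mul_assoc,
      ← Matrix.mul_assoc Vᵀ, hV, Matrix.one_mul, hW']
  have hcross : (Xᵀ * (U * (V * Wᵀ))).trace = ∑ i, s i := by
    rw [← Matrix.mul_assoc, ← Matrix.mul_assoc, hsvd, Matrix.mul_assoc, Matrix.trace_mul_comm,
      Matrix.mul_assoc, hW, Matrix.mul_one, Matrix.trace_diagonal]
  have hself : (U * (V * Wᵀ))ᵀ * (U * (V * Wᵀ)) = 1 := by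
    calc (U * (V * Wᵀ))ᵀ * (U * (V * Wᵀ)) = W * (Vᵀ * (Uᵀ * U) * V) * Wᵀ := by
          simp only [Matrix.transpose_mul, Matrix.transpose_transpose, Matrix.mul_assoc]
      _ = 1 := by rw [hU, Matrix.mul_one, hV, Matrix.mul_one, hW']
  have hcross' : ((U * (V * Wᵀ))ᵀ * X).trace = ∑ i, s i := by
    rw [← hcross, ← Matrix.trace_transpose, Matrix.transpose_mul, Matrix.transpose_transpose]
  have htrace : ((X - U * (V * Wᵀ))ᵀ * (X - U * (V * Wᵀ))).trace = ∑ i, (2 - 2 * s i) := by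
    rw [Matrix.transpose_sub, Matrix.sub_mul, Matrix.mul_sub, Matrix.mul_sub, hX, hself]
    simp only [Matrix.trace_sub, hcross, hcross', Matrix.trace_one, Finset.sum_sub_distrib,
      ← Finset.mul_sum, Finset.sum_const, Finset.card_univ, nsmul_eq_mul]
    ring
  rw [frobNorm_eq_sqrt_trace, htrace]
  refine Real.sqrt_le_iff.mpr ⟨mul_nonneg (Real.sqrt_nonneg _) (hτ.trans h), ?_⟩
  rw [mul_pow, Real.sq_sqrt (by positivity)]
  calc ∑ i, (2 - 2 * s i) ≤ ∑ _i : Fin k, 2 * τ ^ 2 := Finset.sum_le_sum fun i _ => hterm i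
    _ = 2 * k * τ ^ 2 := by
      simp only [Finset.sum_const, Finset.card_univ, Fintype.card_fin, nsmul_eq_mul]
      ring

end
end
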